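/- Let G = (S, T, π) be a two-person win-lose game such that every set in the family B¹(G) is finite. Then the following three conditions are equivalent: (1) B¹_down(G) is ascending-union closed; (2) B¹_down(G) contains no countable strictly ascending chain A₁ ⊂ A₂ ⊂ ⋯; (3) G is LNG-free. -/

import Mathlib

/-- A family of sets is ascending-union closed if the union of every countable
strictly ascending chain of members of the family is again a member. -/
def AscendingUnionClosed {X : Type*} (F : Set (Set X)) : Prop :=
  ∀ A : ℕ → Set X, (∀ i, A i ∈ F) → (∀ i, A i ⊂ A (i + 1)) → (⋃ i, A i) ∈ F

/-- `B¹_down(G)`: the downward closure of the family of rows of the game. -/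
def B1down {S T : Type*} (π : S → T → Prop) : Set (Set T) :=
  {A | ∃ s, A ⊆ {t | π s t}}

/-- A game is LNG-free if no subgame of it is isomorphic to the larger number game,
i.e. there are no injective sequences of strategies `s i`, `t j` with
`π (s i) (t j) ↔ j ≤ i`. -/
def LNGFree {S T : Type*} (π : S → T → Prop) : Prop :=
  ¬ ∃ (s : ℕ → S) (t : ℕ → T), Function.Injective s ∧ Function.Injective t ∧
      ∀ i j, π (s i) (t j) ↔ j ≤ i

theorem iUnion_infinite_of_ssubset_succ {X : Type*} {A : ℕ → Set X}
    (hA : ∀ i, A i ⊂ A (i + 1)) : (⋃ i, A i).Infinite := fun hfin =>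
  Set.infinite_range_of_injective (strictMono_nat_of_lt_succ hA).injective <|
    hfin.finite_subsets.subset <| by
      rintro _ ⟨i, rfl⟩
      exact Set.subset_iUnion A i

/-- A sequence of distinct columns, each winning against all later rows of a sequence of rows
with finite winning sets, thins out to a larger number game. -/
theorem not_LNGFree_of_forall_lt {S T : Type*} {π : S → T → Prop}
    (hfin : ∀ s, {t | π s t}.Finite) {s : ℕ → S} {t : ℕ → T} (ht : Function.Injective t)
    (hπ : ∀ i j, j < i → π (s i) (t j)) : ¬ LNGFree π := by
  have hgap : ∀ n, ∃ N, n < N ∧ ∀ m, N ≤ m → ¬ π (s (n + 1)) (t m) := by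
    intro n
    obtain ⟨b, hb⟩ := ((hfin (s (n + 1))).preimage ht.injOn).bddAbove
    refine ⟨max b n + 1, by omega, fun m hm h => ?_⟩
    have : m ≤ b := hb h
    omega
  choose f hlt hf using hgap
  set φ : ℕ → ℕ := fun k => f^[k] 0
  have hsucc : ∀ k, φ (k + 1) = f (φ k) := fun k => Function.iterate_succ_apply' f k 0
  have hφ : StrictMono φ := strictMono_nat_of_lt_succ fun k => hsucc k ▸ hlt (φ k)
  have hlng : ∀ i j, π (s (φ i + 1)) (t (φ j)) ↔ j ≤ i := by
    refine fun i j => ⟨fun h => ?_, fun h => hπ _ _ (Nat.lt_succ_of_le (hφ.monotone h))⟩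
    by_contra! hij
    exact hf (φ i) (φ j) (hsucc i ▸ hφ.monotone hij) h
  refine not_not_intro ⟨fun i => s (φ i + 1), fun j => t (φ j),
    fun i j (hij : s (φ i + 1) = s (φ j + 1)) => ?_, ht.comp hφ.injective, hlng⟩
  refine le_antisymm ((hlng j i).1 ?_) ((hlng i j).1 ?_)
  · exact hij ▸ (hlng i i).2 le_rfl
  · exact hij ▸ (hlng j j).2 le_rfl

theorem not_LNGFree_of_chain {S T : Type*} {π : S → T → Prop}
    (hfin : ∀ s, {t | π s t}.Finite) {A : ℕ → Set T} (hmem : ∀ i, A i ∈ B1down π)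
    (hA : ∀ i, A i ⊂ A (i + 1)) : ¬ LNGFree π := by
  choose s hs using hmem
  choose t htmem htnot using fun i => Set.exists_of_ssubset (hA i)
  have hmono : Monotone A := (strictMono_nat_of_lt_succ hA).monotone
  have hearly : ∀ i j, j < i → t j ∈ A i := fun i j hji => hmono hji (htmem j)
  refine not_LNGFree_of_forall_lt hfin (t := t) (fun i j hij => ?_)
    fun i j hji => hs i (hearly i j hji)
  by_contra hne
  rcases lt_or_gt_of_ne hne with h | h
  · exact htnot j (hij ▸ hearly j i h)
  · exact htnot i (hij ▸ hearly i j h)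

theorem exists_chain_of_not_LNGFree {S T : Type*} {π : S → T → Prop} (h : ¬ LNGFree π) :
    ∃ A : ℕ → Set T, (∀ i, A i ∈ B1down π) ∧ ∀ i, A i ⊂ A (i + 1) := by
  obtain ⟨s, t, -, ht, hπ⟩ := not_not.1 h
  refine ⟨fun i => t '' Set.Iic i, fun i => ⟨s i, ?_⟩, fun i => ?_⟩
  · rintro _ ⟨j, hj, rfl⟩
    exact (hπ i j).2 hj
  · exact ht.image_strictMono (Set.Iic_ssubset_Iic.2 i.lt_succ_self)

/-- Proposition 2.9: if all rows of the game are finite, then `B¹_down(G)` being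
ascending-union closed, `B¹_down(G)` containing no countable strictly ascending chain,
and LNG-freeness of the game are all equivalent. -/
theorem ascendingUnionClosed_iff_noChain_iff_LNGFree
    {S T : Type*} [Nonempty S] [Nonempty T] (π : S → T → Prop)
    (hfin : ∀ s, {t | π s t}.Finite) :
    (AscendingUnionClosed (B1down π) ↔
      ¬ ∃ A : ℕ → Set T, (∀ i, A i ∈ B1down π) ∧ ∀ i, A i ⊂ A (i + 1)) ∧
    ((¬ ∃ A : ℕ → Set T, (∀ i, A i ∈ B1down π) ∧ ∀ i, A i ⊂ A (i + 1)) ↔ LNGFree π) := by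
  refine ⟨⟨?_, fun h A hmem hA => (h ⟨A, hmem, hA⟩).elim⟩, ?_, ?_⟩
  · rintro h ⟨A, hmem, hA⟩
    obtain ⟨s, hs⟩ := h A hmem hA
    exact iUnion_infinite_of_ssubset_succ hA ((hfin s).subset hs)
  · exact fun h => by_contra fun hL => h (exists_chain_of_not_LNGFree hL)
  · rintro hL ⟨A, hmem, hA⟩
    exact not_LNGFree_of_chain hfin hmem hA hL
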